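/- If nonnegative vectors q^(0), …, q^(N), r^(0), …, r^(N) ∈ ℝ^V satisfy the GFPush invariant for s, then all reserve and residue vectors are sub-probability vectors: ‖q^(n)‖₁ ≤ 1 for every 0 ≤ n ≤ N, and ‖r^(m)‖₁ ≤ 1 for every 0 ≤ m ≤ N−1. (The bound ‖r^(n−1)‖₁ ≤ 1 used in the complexity analysis of Theorem 1.) -/

import Mathlib

open Finset Matrix

/-- The row-normalized adjacency matrix `P = D̃⁻¹ Ã` of the self-loop-augmented graph `G̃`. -/
noncomputable def rowNormAdj (V : Type) [Fintype V] [DecidableEq V]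
    (G : SimpleGraph V) [DecidableRel G.Adj] : Matrix V V ℝ :=
  Matrix.of fun v u => if u = v ∨ G.Adj v u then 1 / ((G.degree v : ℝ) + 1) else 0

/-- Every row of `rowNormAdj V G` is a probability vector. -/
theorem rowNormAdj_mem_rowStochastic {V : Type} [Fintype V] [DecidableEq V]
    (G : SimpleGraph V) [DecidableRel G.Adj] : rowNormAdj V G ∈ rowStochastic ℝ V := by
  rw [mem_rowStochastic_iff_sum]
  refine ⟨fun v u => ?_, fun v => ?_⟩
  · rw [rowNormAdj, Matrix.of_apply]
    split_ifs <;> positivity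
  · have hfilter : (univ.filter fun u => u = v ∨ G.Adj v u) = insert v (G.neighborFinset v) := by
      ext u
      simp
    have hdeg : (G.degree v : ℝ) + 1 ≠ 0 := by positivity
    simp only [rowNormAdj, Matrix.of_apply]
    rw [← Finset.sum_filter, hfilter, Finset.sum_const,
      Finset.card_insert_of_notMem (by simp), G.card_neighborFinset_eq_degree, nsmul_eq_mul]
    push_cast
    exact mul_one_div_cancel hdeg

/-- The transpose of a row-stochastic matrix preserves the total mass of a vector. -/
theorem sum_transpose_mulVec_of_mem_rowStochastic {V : Type*} [Fintype V] [DecidableEq V]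
    {M : Matrix V V ℝ} (hM : M ∈ rowStochastic ℝ V) (x : V → ℝ) :
    ∑ u, (Mᵀ.mulVec x) u = ∑ u, x u := by
  simp only [Matrix.mulVec, dotProduct, Matrix.transpose_apply]
  rw [Finset.sum_comm]
  simp only [← Finset.sum_mul, sum_row_of_mem_rowStochastic hM, one_mul]

/-- The bound `‖r⁽ⁿ⁻¹⁾‖₁ ≤ 1` used in the complexity analysis of Theorem 1 of "GRAND+":
if nonnegative vectors `q⁽⁰⁾, …, q⁽ᴺ⁾, r⁽⁰⁾, …, r⁽ᴺ⁾` satisfy the GFPush invariant for `s`,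
then all reserve and residue vectors are sub-probability vectors: `‖q⁽ⁿ⁾‖₁ ≤ 1` for every
`0 ≤ n ≤ N` and `‖r⁽ᵐ⁾‖₁ ≤ 1` for every `0 ≤ m ≤ N − 1`. -/
theorem gfpush_subprobability
    {V : Type} [Fintype V] [DecidableEq V]
    (G : SimpleGraph V) [DecidableRel G.Adj]
    (s : V) (N : ℕ) (hN : 1 ≤ N)
    (q r : ℕ → V → ℝ)
    (hq : ∀ n ≤ N, ∀ u, 0 ≤ q n u)
    (hr : ∀ n ≤ N, ∀ u, 0 ≤ r n u)
    (hinv : ∀ n ≤ N, ∀ u, (rowNormAdj V G ^ n) s u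
      = q n u + ∑ i ∈ Finset.Icc 1 n, ((rowNormAdj V G ^ i)ᵀ.mulVec (r (n - i))) u) :
    (∀ n ≤ N, ∑ u, |q n u| ≤ 1) ∧ (∀ m < N, ∑ u, |r m u| ≤ 1) := by
  have hpow (i : ℕ) : rowNormAdj V G ^ i ∈ rowStochastic ℝ V :=
    pow_mem (rowNormAdj_mem_rowStochastic G) i
  have hmass : ∀ n ≤ N, ∑ u, q n u + ∑ i ∈ Finset.Icc 1 n, ∑ u, r (n - i) u = 1 := by
    intro n hn
    rw [← sum_row_of_mem_rowStochastic (hpow n) s, Finset.sum_congr rfl fun u _ => hinv n hn u,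
      Finset.sum_add_distrib, Finset.sum_comm (s := univ)]
    simp only [sum_transpose_mulVec_of_mem_rowStochastic (hpow _)]
  have hq_sum : ∀ n ≤ N, 0 ≤ ∑ u, q n u := fun n hn => Finset.sum_nonneg fun u _ => hq n hn u
  have hr_sum : ∀ n ≤ N, ∀ i ∈ Finset.Icc 1 n, 0 ≤ ∑ u, r (n - i) u := fun n hn i _ =>
    Finset.sum_nonneg fun u _ => hr (n - i) ((Nat.sub_le n i).trans hn) u
  refine ⟨fun n hn => ?_, fun m hm => ?_⟩
  · simp only [abs_of_nonneg (hq n hn _)]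
    linarith [hmass n hn, Finset.sum_nonneg (hr_sum n hn)]
  · simp only [abs_of_nonneg (hr m hm.le _)]
    have hterm := Finset.single_le_sum (hr_sum (m + 1) hm) (Finset.mem_Icc.2 ⟨le_rfl, by omega⟩)
    rw [Nat.add_sub_cancel] at hterm
    linarith [hmass (m + 1) hm, hq_sum (m + 1) hm]
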